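/- arXiv:1907.12497 — 2 statements merged into one kernel-verified Lean document; each statement's English description precedes it below -/
import Mathlib

section
/- Let A be an m-homogeneous supersolvable line arrangement in ℙ² consisting of d = |A| lines, which is not a pencil, and suppose 2m ≥ d. Then n₂ ≥ d/2. -/
open scoped LinearAlgebra.Projectivization

noncomputable section

attribute [local instance] Classical.propDecidable

/-- A point of the complex projective plane. -/
abbrev ProjPoint := ℙ ℂ (Fin 3 → ℂ)

/-- A line of the complex projective plane, encoded by a defining linear form
up to scalar, i.e. as a point of the dual projective plane. -/
abbrev ProjLine := ℙ ℂ (Module.Dual ℂ (Fin 3 → ℂ))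

/-- The incidence relation between points and lines of `ℙ²`. -/
def PointOnLine (p : ProjPoint) (L : ProjLine) : Prop :=
  L.rep p.rep = 0

/-- The multiplicity of a point with respect to a line arrangement:
the number of lines of the arrangement passing through the point. -/
def mult (A : Finset ProjLine) (p : ProjPoint) : ℕ :=
  Set.ncard {L : ProjLine | L ∈ A ∧ PointOnLine p L}

/-- An intersection point of a line arrangement: a point lying on at least two lines. -/
def IsIntersectionPoint (A : Finset ProjLine) (p : ProjPoint) : Prop :=
  2 ≤ mult A p

/-- A modular point: an intersection point `p` such that for any other intersection
point `q`, the line through `p` and `q` belongs to the arrangement. -/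
def IsModular (A : Finset ProjLine) (p : ProjPoint) : Prop :=
  IsIntersectionPoint A p ∧
    ∀ q : ProjPoint, IsIntersectionPoint A q → q ≠ p →
      ∃ L ∈ A, PointOnLine p L ∧ PointOnLine q L

/-- A supersolvable line arrangement: one possessing a modular point. -/
def IsSupersolvable (A : Finset ProjLine) : Prop :=
  ∃ p, IsModular A p

/-- An `m`-homogeneous supersolvable line arrangement: supersolvable, and all
modular points have multiplicity `m`. -/
def IsHomogSS (A : Finset ProjLine) (m : ℕ) : Prop :=
  IsSupersolvable A ∧ ∀ p, IsModular A p → mult A p = m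

/-- `nk A k` is the number of intersection points of multiplicity `k` of `A`. -/
def nk (A : Finset ProjLine) (k : ℕ) : ℕ :=
  Set.ncard {p : ProjPoint | IsIntersectionPoint A p ∧ mult A p = k}

/-- A pencil: all lines pass through a common point. -/
def IsPencil (A : Finset ProjLine) : Prop :=
  ∃ p, ∀ L ∈ A, PointOnLine p L

theorem line_scale (L : ProjLine) (a : ℂ) (v w : Fin 3 → ℂ) (h : w = a • v) (hv : L.rep v = 0) :
    L.rep w = 0 := by
  rw [h, map_smul, hv, smul_zero]

/-- Two distinct lines meet in exactly one point. -/
theorem meet_unique (L M : ProjLine) (h : L ≠ M) :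
    ∃ p : ProjPoint, (PointOnLine p L ∧ PointOnLine p M) ∧
      ∀ q : ProjPoint, PointOnLine q L → PointOnLine q M → q = p := by
  have hli : LinearIndependent ℂ ![L.rep, M.rep] := by
    have h1 := (Projectivization.independent_pair_iff_ne L M).2 h
    rw [Projectivization.independent_iff] at h1
    have h2 : (Projectivization.rep ∘ ![L, M]) = ![L.rep, M.rep] := by
      ext i : 1
      fin_cases i <;> rfl
    rw [h2] at h1
    exact h1
  have hf := finrank_span_eq_card hli
  have h3 := Subspace.finrank_add_finrank_dualCoannihilator_eq
    (Submodule.span ℂ (Set.range ![L.rep, M.rep]))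
  rw [hf] at h3
  simp only [Fintype.card_fin, Module.finrank_fin_fun] at h3
  have h4 : Module.finrank ℂ
      (Submodule.span ℂ (Set.range ![L.rep, M.rep])).dualCoannihilator = 1 := by omega
  have hmem : ∀ v : Fin 3 → ℂ,
      v ∈ (Submodule.span ℂ (Set.range ![L.rep, M.rep])).dualCoannihilator ↔
        L.rep v = 0 ∧ M.rep v = 0 := by
    intro v
    rw [Submodule.mem_dualCoannihilator]
    constructor
    · intro hv
      exact ⟨hv _ (Submodule.subset_span ⟨0, rfl⟩), hv _ (Submodule.subset_span ⟨1, rfl⟩)⟩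
    · rintro ⟨h1, h2⟩ φ hφ
      induction hφ using Submodule.span_induction with
      | mem x hx =>
        obtain ⟨i, rfl⟩ := hx
        fin_cases i
        · exact h1
        · exact h2
      | zero => rfl
      | add x y _ _ hx hy => rw [LinearMap.add_apply, hx, hy, add_zero]
      | smul a x _ hx => rw [LinearMap.smul_apply, hx, smul_zero]
  obtain ⟨⟨v, hv⟩, hv0, hall⟩ := finrank_eq_one_iff'.1 h4
  have hv0' : v ≠ 0 := fun h0 => hv0 (Subtype.ext h0)
  obtain ⟨a, ha⟩ := Projectivization.exists_smul_eq_mk_rep ℂ v hv0'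
  have hv' := (hmem v).1 hv
  refine ⟨Projectivization.mk ℂ v hv0',
    ⟨line_scale L a v _ ha.symm hv'.1, line_scale M a v _ ha.symm hv'.2⟩, ?_⟩
  intro q hqL hqM
  obtain ⟨c, hc⟩ := hall ⟨q.rep, (hmem _).2 ⟨hqL, hqM⟩⟩
  rw [← q.mk_rep]
  rw [Projectivization.mk_eq_mk_iff']
  exact ⟨c, congrArg Subtype.val hc⟩

theorem line_eq_of_two_points {L M : ProjLine} {p q : ProjPoint} (hpq : p ≠ q)
    (h1 : PointOnLine p L) (h2 : PointOnLine p M) (h3 : PointOnLine q L)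
    (h4 : PointOnLine q M) : L = M := by
  by_contra h
  obtain ⟨r, -, hr⟩ := meet_unique L M h
  exact hpq ((hr p h1 h2).trans (hr q h3 h4).symm)

theorem mult_eq_card (A : Finset ProjLine) (p : ProjPoint) :
    mult A p = (A.filter (fun L => PointOnLine p L)).card := by
  rw [mult, ← Set.ncard_coe_finset]
  congr 1
  ext L
  simp

/-- A chosen common point of two lines. -/
def meetPt (L M : ProjLine) : ProjPoint :=
  if h : L ≠ M then (meet_unique L M h).choose else Projectivization.mk ℂ 1 one_ne_zero

theorem meetPt_left {L M : ProjLine} (h : L ≠ M) : PointOnLine (meetPt L M) L := by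
  rw [meetPt, dif_pos h]; exact (meet_unique L M h).choose_spec.1.1

theorem meetPt_right {L M : ProjLine} (h : L ≠ M) : PointOnLine (meetPt L M) M := by
  rw [meetPt, dif_pos h]; exact (meet_unique L M h).choose_spec.1.2

theorem meetPt_uniq {L M : ProjLine} (h : L ≠ M) {q : ProjPoint} (h1 : PointOnLine q L)
    (h2 : PointOnLine q M) : q = meetPt L M := by
  rw [meetPt, dif_pos h]; exact (meet_unique L M h).choose_spec.2 q h1 h2

theorem finite_double (A : Finset ProjLine) :
    {p : ProjPoint | IsIntersectionPoint A p ∧ mult A p = 2}.Finite := by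
  refine Set.Finite.subset ((A ×ˢ A).image (fun x => meetPt x.1 x.2)).finite_toSet ?_
  rintro q ⟨hq, -⟩
  rw [IsIntersectionPoint, mult_eq_card] at hq
  obtain ⟨L, hL, M, hM, hne⟩ := Finset.one_lt_card.1 hq
  rw [Finset.mem_filter] at hL hM
  rw [Finset.mem_coe, Finset.mem_image]
  exact ⟨(L, M), Finset.mem_product.2 ⟨hL.1, hM.1⟩, (meetPt_uniq hne hL.2 hM.2).symm⟩

/-- Core count: a line off `p` has few non-double points on the lines through `p`. -/
theorem bad_card_le (A : Finset ProjLine) (p : ProjPoint) (L : ProjLine) (hLA : L ∈ A)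
    (hLp : ¬ PointOnLine p L) :
    ((A.filter (fun M => PointOnLine p M)).filter
      (fun M => ¬ mult A (meetPt L M) = 2)).card ≤
      ((A.filter (fun M => ¬ PointOnLine p M)).erase L).card := by
  have key : ∀ M ∈ (A.filter (fun M => PointOnLine p M)).filter
      (fun M => ¬ mult A (meetPt L M) = 2),
      ∃ N ∈ (A.filter (fun M => ¬ PointOnLine p M)).erase L,
        PointOnLine (meetPt L M) N := by
    intro M hM
    rw [Finset.mem_filter, Finset.mem_filter] at hM
    obtain ⟨⟨hMA, hMp⟩, hM2⟩ := hM
    have hne : L ≠ M := fun h => hLp (h ▸ hMp)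
    have hqp : meetPt L M ≠ p := fun h => hLp (h ▸ meetPt_left hne)
    by_contra hcon
    push Not at hcon
    apply hM2
    rw [mult_eq_card]
    have : A.filter (fun K => PointOnLine (meetPt L M) K) = {L, M} := by
      ext K
      rw [Finset.mem_filter, Finset.mem_insert, Finset.mem_singleton]
      constructor
      · rintro ⟨hK, hKq⟩
        by_contra hh
        push Not at hh
        by_cases hKp : PointOnLine p K
        · exact hh.2 (line_eq_of_two_points hqp hKq (meetPt_right hne) hKp hMp)
        · exact hcon K (Finset.mem_erase.2 ⟨hh.1, Finset.mem_filter.2 ⟨hK, hKp⟩⟩) hKq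
      · rintro (rfl | rfl)
        · exact ⟨hLA, meetPt_left hne⟩
        · exact ⟨hMA, meetPt_right hne⟩
    rw [this, Finset.card_pair hne]
  choose! f hf hf' using key
  refine Finset.card_le_card_of_injOn f hf ?_
  intro M hM M' hM' hEq
  rw [Finset.mem_coe] at hM hM'
  have hNL : L ≠ f M := (Finset.mem_erase.1 (hf M hM)).1.symm
  have e1 := hf' M hM
  have e2 := hf' M' hM'
  rw [← hEq] at e2
  rw [Finset.mem_filter, Finset.mem_filter] at hM hM'
  have hne : L ≠ M := fun h => hLp (h ▸ hM.1.2)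
  have hne' : L ≠ M' := fun h => hLp (h ▸ hM'.1.2)
  have e3 : meetPt L M = meetPt L M' :=
    (meetPt_uniq hNL (meetPt_left hne) e1).trans (meetPt_uniq hNL (meetPt_left hne') e2).symm
  have hqp : meetPt L M ≠ p := fun h => hLp (h ▸ meetPt_left hne)
  exact line_eq_of_two_points hqp (meetPt_right hne) (e3 ▸ meetPt_right hne') hM.1.2 hM'.1.2

theorem double_count (A : Finset ProjLine) (p : ProjPoint) :
    (A.filter (fun M => ¬ PointOnLine p M)).card *
      (mult A p + 1 - (A.filter (fun M => ¬ PointOnLine p M)).card) ≤ nk A 2 := by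
  have hS : ∀ L ∈ A.filter (fun M => ¬ PointOnLine p M),
      mult A p + 1 - (A.filter (fun M => ¬ PointOnLine p M)).card ≤
      ((A.filter (fun M => PointOnLine p M)).filter (fun M => mult A (meetPt L M) = 2)).card := by
    intro L hL
    have hL' := Finset.mem_filter.1 hL
    have h1 := bad_card_le A p L hL'.1 hL'.2
    have h2 := Finset.card_filter_add_card_filter_not (s := A.filter (fun M => PointOnLine p M))
      (fun M => mult A (meetPt L M) = 2)
    have h3 := Finset.card_erase_add_one hL
    rw [mult_eq_card]
    omega
  have h4 := Finset.card_nsmul_le_sum _ _ _ hS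
  rw [← Finset.card_sigma, smul_eq_mul] at h4
  refine h4.trans ?_
  rw [nk, Set.ncard_eq_toFinset_card _ (finite_double A)]
  refine Finset.card_le_card_of_injOn (fun x => meetPt x.1 x.2) ?_ ?_
  · rintro ⟨L, M⟩ hx
    simp only [Finset.coe_sigma, Set.mem_sigma_iff, Finset.mem_coe, Finset.mem_filter] at hx
    simp only [Set.Finite.coe_toFinset, Set.mem_ofPred_eq, IsIntersectionPoint]
    exact ⟨hx.2.2.ge, hx.2.2⟩
  · rintro ⟨L, M⟩ hx ⟨L', M'⟩ hx' hEq
    simp only [Finset.coe_sigma, Set.mem_sigma_iff, Finset.mem_coe, Finset.mem_filter] at hx hx' hEq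
    obtain ⟨⟨hLA, hLp⟩, ⟨hMA, hMp⟩, h2⟩ := hx
    obtain ⟨⟨hLA', hLp'⟩, ⟨hMA', hMp'⟩, h2'⟩ := hx'
    have hne : L ≠ M := fun h => hLp (h ▸ hMp)
    have hne' : L' ≠ M' := fun h => hLp' (h ▸ hMp')
    have hqp : meetPt L M ≠ p := fun h => hLp (h ▸ meetPt_left hne)
    have hM : M = M' :=
      line_eq_of_two_points hqp (meetPt_right hne) (hEq ▸ meetPt_right hne') hMp hMp'
    subst hM
    have hLL : L = L' := by
      by_contra hLL
      have h3 : ({L, L', M} : Finset ProjLine).card = 3 := Finset.card_eq_three.2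
        ⟨L, L', M, hLL, hne, hne', rfl⟩
      have h4 : ({L, L', M} : Finset ProjLine) ⊆
          A.filter (fun K => PointOnLine (meetPt L M) K) := by
        intro K hK
        simp only [Finset.mem_insert, Finset.mem_singleton] at hK
        rw [Finset.mem_filter]
        rcases hK with rfl | rfl | rfl
        · exact ⟨hLA, meetPt_left hne⟩
        · exact ⟨hLA', hEq ▸ meetPt_left hne'⟩
        · exact ⟨hMA, meetPt_right hne⟩
      have h5 := Finset.card_le_card h4
      rw [mult_eq_card] at h2
      omega
    subst hLL
    rfl

/-- An `m`-homogeneous supersolvable line arrangement with `d` lines,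
not a pencil, with `2m ≥ d`, satisfies `n₂ ≥ d/2`. -/
theorem n2_ge_half_of_two_m_ge_d (A : Finset ProjLine) (m : ℕ)
    (h : IsHomogSS A m) (hpencil : ¬ IsPencil A)
    (hd : (A.card : ℝ) ≤ 2 * m) :
    (A.card : ℝ) / 2 ≤ (nk A 2 : ℝ) := by
  obtain ⟨⟨p, hp⟩, hm⟩ := h
  have hpm := hm p hp
  have hcount := double_count A p
  have hsplit := Finset.card_filter_add_card_filter_not (s := A) (fun M => PointOnLine p M)
  rw [← mult_eq_card] at hsplit
  rw [hpm] at hcount hsplit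
  have hpos : 1 ≤ (A.filter (fun M => ¬ PointOnLine p M)).card := by
    rw [Nat.one_le_iff_ne_zero, Finset.card_ne_zero]
    by_contra hne
    rw [Finset.not_nonempty_iff_eq_empty, Finset.filter_eq_empty_iff] at hne
    exact hpencil ⟨p, fun L hL => not_not.1 (hne hL)⟩
  have hd' : A.card ≤ 2 * m := by exact_mod_cast hd
  generalize (A.filter (fun M => ¬ PointOnLine p M)).card = b at *
  have hbm : b ≤ m := by omega
  obtain ⟨c, rfl⟩ := Nat.exists_eq_add_of_le hbm
  have e : b + c + 1 - b = c + 1 := by omega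
  rw [e] at hcount
  have hge : b + c ≤ nk A 2 := by nlinarith
  have hge' : ((b + c : ℕ) : ℝ) ≤ (nk A 2 : ℝ) := by exact_mod_cast hge
  linarith

end
end

section
/- Let A' be an arbitrary arrangement of d' ≥ 3 lines in ℙ² which is not a pencil, let p be a generic vertex (a point not on any line of A' and not collinear with any two distinct intersection points of A'), and let A = C(A',p)_e for any e ≥ 0. Then, with d = |A|, the number of double points of A satisfies n₂ ≥ d/2. -/
open scoped LinearAlgebra.Projectivization

noncomputable section

attribute [local instance] Classical.propDecidable

/-- A generic line arrangement: all intersection points are double points. -/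
def IsGeneric (A : Finset ProjLine) : Prop :=
  ∀ p, IsIntersectionPoint A p → mult A p = 2

/-- `A` is the cone `C(A',p)_e` over `A'` with vertex `p`: the point `p` lies on no
line of `A'`, and `A` consists of the lines of `A'`, all the lines joining `p` to the
intersection points of `A'`, and `e` further distinct lines through `p`, each meeting
the lines of `A'` only in points lying on exactly one line of `A'`. -/
def IsConeOf (A' : Finset ProjLine) (p : ProjPoint) (e : ℕ) (A : Finset ProjLine) : Prop :=
  (∀ L ∈ A', ¬ PointOnLine p L) ∧
  ∃ E : Finset ProjLine, E.card = e ∧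
    (∀ L ∈ E, PointOnLine p L ∧ ∀ q : ProjPoint, PointOnLine q L → mult A' q ≤ 1) ∧
    ∀ L : ProjLine, L ∈ A ↔ (L ∈ A' ∨ L ∈ E ∨
      (PointOnLine p L ∧ ∃ q : ProjPoint, IsIntersectionPoint A' q ∧ PointOnLine q L))

def dualize (L : ProjLine) : ProjPoint :=
  Projectivization.map (dotProductEquiv ℂ (Fin 3)).symm.toLinearMap
    (dotProductEquiv ℂ (Fin 3)).symm.injective L

lemma dualize_injective : Function.Injective dualize :=
  Projectivization.map_injective _ (dotProductEquiv ℂ (Fin 3)).symm.injective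

lemma pointOnLine_iff (p : ProjPoint) (L : ProjLine) :
    PointOnLine p L ↔ Projectivization.orthogonal p (dualize L) := by
  have h1 : dualize L = Projectivization.mk ℂ ((dotProductEquiv ℂ (Fin 3)).symm L.rep)
      (by simpa using L.rep_nonzero) := by
    conv_lhs => rw [← L.mk_rep]
    rfl
  have h2 : L.rep p.rep = (dotProductEquiv ℂ (Fin 3)).symm L.rep ⬝ᵥ p.rep := by
    conv_lhs => rw [← (dotProductEquiv ℂ (Fin 3)).apply_symm_apply L.rep]
    rfl
  conv_rhs => rw [← p.mk_rep, h1, Projectivization.orthogonal_mk, dotProduct_comm, ← h2]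
  rfl

lemma dualize_surjective : Function.Surjective dualize := by
  intro v
  induction v using Projectivization.ind with | h v hv =>
  refine ⟨Projectivization.mk ℂ (dotProductEquiv ℂ (Fin 3) v) (by simpa using hv), ?_⟩
  unfold dualize
  rw [Projectivization.map_mk]
  congr 1
  exact (dotProductEquiv ℂ (Fin 3)).symm_apply_apply v

lemma line_unique {p q : ProjPoint} {L M : ProjLine} (hpq : p ≠ q)
    (h1 : PointOnLine p L) (h2 : PointOnLine q L) (h3 : PointOnLine p M)
    (h4 : PointOnLine q M) : L = M := by
  rw [pointOnLine_iff] at h1 h2 h3 h4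
  exact dualize_injective
    ((Configuration.Nondegenerate.eq_or_eq (P := ProjPoint) (L := ProjPoint)
      (p₁ := p) (p₂ := q) (l₁ := dualize L) (l₂ := dualize M) h1 h2 h3 h4).resolve_left hpq)

lemma exists_meet {L M : ProjLine} (h : L ≠ M) :
    ∃ x, PointOnLine x L ∧ PointOnLine x M := by
  have h' : dualize L ≠ dualize M := fun hh => h (dualize_injective hh)
  exact ⟨Projectivization.cross (dualize L) (dualize M),
    (pointOnLine_iff _ _).2 (Projectivization.cross_orthogonal_left h'),
    (pointOnLine_iff _ _).2 (Projectivization.cross_orthogonal_right h')⟩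

lemma exists_join {p q : ProjPoint} (h : p ≠ q) :
    ∃ L, PointOnLine p L ∧ PointOnLine q L := by
  obtain ⟨L, hL⟩ := dualize_surjective (Projectivization.cross p q)
  refine ⟨L, ?_, ?_⟩
  · rw [pointOnLine_iff, hL]; exact Projectivization.orthogonal_cross_left h
  · rw [pointOnLine_iff, hL]; exact Projectivization.orthogonal_cross_right h

lemma mult_set_finite (A : Finset ProjLine) (p : ProjPoint) :
    {L : ProjLine | L ∈ A ∧ PointOnLine p L}.Finite :=
  A.finite_toSet.subset fun _ h => h.1

lemma isInt_iff (A : Finset ProjLine) (x : ProjPoint) :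
    IsIntersectionPoint A x ↔
      ∃ L ∈ A, ∃ M ∈ A, L ≠ M ∧ PointOnLine x L ∧ PointOnLine x M := by
  unfold IsIntersectionPoint mult
  rw [← Nat.lt_iff_add_one_le, Set.one_lt_ncard_iff (mult_set_finite A x)]
  constructor
  · rintro ⟨L, M, hL, hM, h⟩
    exact ⟨L, hL.1, M, hM.1, h, hL.2, hM.2⟩
  · rintro ⟨L, hL, M, hM, h, h1, h2⟩
    exact ⟨L, M, ⟨hL, h1⟩, ⟨hM, h2⟩, h⟩

lemma finite_int (A : Finset ProjLine) : {x | IsIntersectionPoint A x}.Finite := by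
  have h : (⋃ L ∈ A, ⋃ M ∈ A,
      {x : ProjPoint | L ≠ M ∧ PointOnLine x L ∧ PointOnLine x M}).Finite := by
    refine A.finite_toSet.biUnion fun L _ => A.finite_toSet.biUnion fun M _ => ?_
    refine Set.Subsingleton.finite ?_
    rintro x ⟨h, hx, hx'⟩ y ⟨_, hy, hy'⟩
    by_contra hxy
    exact h (line_unique hxy hx hy hx' hy')
  refine h.subset fun x hx => ?_
  obtain ⟨L, hL, M, hM, hLM⟩ := (isInt_iff A x).1 hx
  simp only [Set.mem_iUnion]
  exact ⟨L, hL, M, hM, hLM⟩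

lemma exists_int_off {A : Finset ProjLine} (hd : 3 ≤ A.card) (hp : ¬ IsPencil A)
    {L : ProjLine} (hL : L ∈ A) :
    ∃ q, IsIntersectionPoint A q ∧ ¬ PointOnLine q L := by
  by_contra! hc
  obtain ⟨K, hK, hKL⟩ := Finset.exists_mem_ne (by omega : 1 < A.card) L
  obtain ⟨y, hyK, hyL⟩ := exists_meet hKL
  unfold IsPencil at hp
  push Not at hp
  obtain ⟨N, hN, hyN⟩ := hp y
  have hKN : K ≠ N := by rintro rfl; exact hyN hyK
  obtain ⟨q, hqK, hqN⟩ := exists_meet hKN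
  have hqL := hc q ((isInt_iff A q).2 ⟨K, hK, N, hN, hKN, hqK, hqN⟩)
  have hqy : q ≠ y := by rintro rfl; exact hyN hqN
  exact hKL (line_unique hqy hqK hyK hqL hyL)

/-- A cone `A = C(A',p)_e` over an arbitrary arrangement `A'` of
`d' ≥ 3` lines, which is not a pencil, with a generic vertex `p` (on no line of `A'`
and collinear with no two distinct intersection points of `A'`),
satisfies `n₂ ≥ |A|/2`. -/
theorem n2_ge_half_of_cone_generic_vertex (A' A : Finset ProjLine) (p : ProjPoint)
    (e : ℕ) (hd' : 3 ≤ A'.card) (hpencil : ¬ IsPencil A')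
    (hvertex : ∀ q q' : ProjPoint, IsIntersectionPoint A' q → IsIntersectionPoint A' q' →
      q ≠ q' → ∀ L : ProjLine, PointOnLine p L →
        ¬ (PointOnLine q L ∧ PointOnLine q' L))
    (hcone : IsConeOf A' p e A) :
    (A.card : ℝ) / 2 ≤ (nk A 2 : ℝ) := by
  obtain ⟨hpA, E, -, hE, hA⟩ := hcone
  have hsub : ∀ N ∈ A, N ∈ A' ∨ PointOnLine p N := by
    intro N hN
    rcases (hA N).1 hN with h | h | h
    · exact Or.inl h
    · exact Or.inr (hE N h).1
    · exact Or.inr h.1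
  -- a point `x` on `M ∋ p` and on `L`, simple for `A'`, lies on no other line of `A`
  have huniq : ∀ M L x, PointOnLine p M → L ∈ A' → PointOnLine x M → PointOnLine x L →
      ¬ IsIntersectionPoint A' x → ∀ N ∈ A, PointOnLine x N →
      (N ∈ A' → N = L) ∧ (PointOnLine p N → N = M) := by
    intro M L x hpM hL hxM hxL hx N hN hxN
    constructor
    · intro hN'
      by_contra hne
      exact hx ((isInt_iff _ _).2 ⟨N, hN', L, hL, hne, hxN, hxL⟩)
    · intro hpN
      have hpx : p ≠ x := by rintro rfl; exact hpA L hL hxL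
      exact line_unique hpx hpN hxN hpM hxM
  have hdouble : ∀ M L x, M ∈ A → PointOnLine p M → L ∈ A' → PointOnLine x M →
      PointOnLine x L → ¬ IsIntersectionPoint A' x →
      x ∈ {x | IsIntersectionPoint A x ∧ mult A x = 2} := by
    intro M L x hM hpM hL hxM hxL hx
    have hML : M ≠ L := by rintro rfl; exact hpA M hL hpM
    have h2 : mult A x = 2 := by
      have hset : {N : ProjLine | N ∈ A ∧ PointOnLine x N} = {M, L} := by
        ext N
        simp only [Set.mem_setOf_eq, Set.mem_insert_iff, Set.mem_singleton_iff]
        constructor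
        · rintro ⟨hN, hxN⟩
          have := huniq M L x hpM hL hxM hxL hx N hN hxN
          rcases hsub N hN with h | h
          · exact Or.inr (this.1 h)
          · exact Or.inl (this.2 h)
        · rintro (rfl | rfl)
          · exact ⟨hM, hxM⟩
          · exact ⟨(hA _).2 (Or.inl hL), hxL⟩
      unfold mult
      rw [hset, Set.ncard_pair hML]
    exact ⟨h2.ge, h2⟩
  have hfin : {x | IsIntersectionPoint A x ∧ mult A x = 2}.Finite :=
    (finite_int A).subset fun _ h => h.1
  -- every line of `A` through `p` carries a double point
  have hC : ∀ M, ∃ x, M ∈ A.filter (fun M => PointOnLine p M) →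
      ∃ L ∈ A', PointOnLine x M ∧ PointOnLine x L ∧ ¬ IsIntersectionPoint A' x := by
    intro M
    by_cases hM : M ∈ A.filter (fun M => PointOnLine p M)
    swap
    · exact ⟨p, fun h => absurd h hM⟩
    obtain ⟨hM, hpM⟩ := Finset.mem_filter.1 hM
    have hne : ∀ L ∈ A', M ≠ L := by
      rintro L hL rfl; exact hpA M hL hpM
    by_cases hq : ∃ q, IsIntersectionPoint A' q ∧ PointOnLine q M
    · obtain ⟨q, hq, hqM⟩ := hq
      unfold IsPencil at hpencil
      push Not at hpencil
      obtain ⟨L, hL, hqL⟩ := hpencil q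
      obtain ⟨x, hxM, hxL⟩ := exists_meet (hne L hL)
      refine ⟨x, fun _ => ⟨L, hL, hxM, hxL, fun hx => ?_⟩⟩
      have hqx : q ≠ x := by rintro rfl; exact hqL hxL
      exact hvertex q x hq hx hqx M hpM ⟨hqM, hxM⟩
    · obtain ⟨L, hL⟩ := Finset.card_pos.1 (by omega : 0 < A'.card)
      obtain ⟨x, hxM, hxL⟩ := exists_meet (hne L hL)
      exact ⟨x, fun _ => ⟨L, hL, hxM, hxL, fun hx => hq ⟨x, hx, hxM⟩⟩⟩
  -- every line of `A'` carries a double point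
  have hL : ∀ L, ∃ x, L ∈ A' →
      ∃ M ∈ A, PointOnLine p M ∧ PointOnLine x M ∧ PointOnLine x L ∧
        ¬ IsIntersectionPoint A' x := by
    intro L
    by_cases hL : L ∈ A'
    swap
    · exact ⟨p, fun h => absurd h hL⟩
    obtain ⟨q, hq, hqL⟩ := exists_int_off hd' hpencil hL
    have hpq : p ≠ q := by
      rintro rfl
      obtain ⟨K, hK, -, -, -, hpK, -⟩ := (isInt_iff _ _).1 hq
      exact hpA K hK hpK
    obtain ⟨M, hpM, hqM⟩ := exists_join hpq
    have hML : M ≠ L := by rintro rfl; exact hqL hqM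
    obtain ⟨x, hxM, hxL⟩ := exists_meet hML
    refine ⟨x, fun _ => ⟨M, (hA M).2 (Or.inr (Or.inr ⟨hpM, q, hq, hqM⟩)), hpM, hxM, hxL,
      fun hx => ?_⟩⟩
    have hqx : q ≠ x := by rintro rfl; exact hqL hxL
    exact hvertex q x hq hx hqx M hpM ⟨hqM, hxM⟩
  choose f hf using hC
  choose g hg using hL
  have hcardC : (A.filter (fun M => PointOnLine p M)).card ≤ nk A 2 := by
    unfold nk
    rw [Set.ncard_eq_toFinset_card _ hfin]
    refine Finset.card_le_card_of_injOn f ?_ ?_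
    · intro M hM
      obtain ⟨L, hL, h1, h2, h3⟩ := hf M hM
      obtain ⟨hM, hpM⟩ := Finset.mem_filter.1 hM
      simpa using hdouble M L _ hM hpM hL h1 h2 h3
    · intro M hM N hN hMN
      obtain ⟨L, hL, h1, h2, h3⟩ := hf M hM
      obtain ⟨-, -, h4, -⟩ := hf N hN
      obtain ⟨hM, hpM⟩ := Finset.mem_filter.1 hM
      obtain ⟨hN, hpN⟩ := Finset.mem_filter.1 hN
      exact ((huniq M L _ hpM hL h1 h2 h3 N hN (hMN ▸ h4)).2 hpN).symm
  have hcardA : A'.card ≤ nk A 2 := by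
    unfold nk
    rw [Set.ncard_eq_toFinset_card _ hfin]
    refine Finset.card_le_card_of_injOn g ?_ ?_
    · intro L hL
      obtain ⟨M, hM, hpM, h1, h2, h3⟩ := hg L hL
      simpa using hdouble M L _ hM hpM hL h1 h2 h3
    · intro L hL N hN hLN
      obtain ⟨M, hM, hpM, h1, h2, h3⟩ := hg L hL
      obtain ⟨-, -, -, -, h4, -⟩ := hg N hN
      exact ((huniq M L _ hpM hL h1 h2 h3 N ((hA N).2 (Or.inl hN)) (hLN ▸ h4)).1 hN).symm
  have hcard : A.card ≤ A'.card + (A.filter (fun M => PointOnLine p M)).card := by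
    refine le_trans (Finset.card_le_card fun N hN => ?_) (Finset.card_union_le _ _)
    rcases hsub N hN with h | h
    · exact Finset.mem_union_left _ h
    · exact Finset.mem_union_right _ (Finset.mem_filter.2 ⟨hN, h⟩)
  have hfinal : A.card ≤ 2 * nk A 2 := by omega
  have : (A.card : ℝ) ≤ 2 * (nk A 2 : ℝ) := by exact_mod_cast hfinal
  linarith

end
end
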